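/- arXiv:1902.03483 — 4 statements merged into one kernel-verified Lean document; each statement's English description precedes it below -/
import Mathlib

section
/- Every prime element γ of ℤ[ρ] is, up to multiplication by a unit of ℤ[ρ], of exactly one of the following three forms: (1) γ = 1 − ρ; (2) γ = p, a rational prime p ∈ ℤ with p ≡ 2 (mod 3); (3) γ is an element whose norm N(γ) equals a rational prime q ∈ ℤ with q ≡ 1 (mod 3), in which case γ and its complex conjugate γ̄ are nonassociate primes of ℤ[ρ] with γγ̄ = q. -/
open Polynomial

/-- The Eisenstein integers `ℤ[ρ]`, realized as `ℤ[X]/(X² + X + 1)`. -/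
abbrev Eisenstein : Type := AdjoinRoot (X ^ 2 + X + 1 : ℤ[X])

/-- The primitive cube root of unity `ρ` in `ℤ[ρ]`. -/
noncomputable def ρ : Eisenstein := AdjoinRoot.root (X ^ 2 + X + 1 : ℤ[X])

/-- The "even" Eisenstein prime `β = 1 - ρ`. -/
noncomputable def β : Eisenstein := 1 - ρ

/-- Category 1: `γ` is an associate of the even prime `β = 1 - ρ`. -/
def IsCat1 (γ : Eisenstein) : Prop := Associated γ β

/-- Category 2: `γ` is an associate of a rational prime `p ≡ 2 (mod 3)`. -/
def IsCat2 (γ : Eisenstein) : Prop :=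
  ∃ p : ℤ, Prime p ∧ p ≡ 2 [ZMOD 3] ∧ Associated γ ((p : Eisenstein))

/-- Category 3: `γ` is an associate of a prime `a + bρ` whose norm `a² - ab + b²` is a
rational prime `q ≡ 1 (mod 3)`; moreover `a + bρ` and its conjugate `(a - b) - bρ` are
nonassociate primes whose product is `q`. -/
def IsCat3 (γ : Eisenstein) : Prop :=
  ∃ a b q : ℤ, Prime q ∧ q ≡ 1 [ZMOD 3] ∧ a ^ 2 - a * b + b ^ 2 = q ∧
    Associated γ ((a : Eisenstein) + b * ρ) ∧
    Prime ((a : Eisenstein) + b * ρ) ∧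
    Prime (((a - b : ℤ) : Eisenstein) - b * ρ) ∧
    ¬ Associated ((a : Eisenstein) + b * ρ) (((a - b : ℤ) : Eisenstein) - b * ρ) ∧
    ((a : Eisenstein) + b * ρ) * (((a - b : ℤ) : Eisenstein) - b * ρ) = (q : Eisenstein)

namespace Eisenstein

lemma rho_sq : ρ ^ 2 = -1 - ρ := by
  have h : AdjoinRoot.mk (X ^ 2 + X + 1 : ℤ[X]) (X ^ 2 + X + 1) = 0 := AdjoinRoot.mk_self
  simp only [map_add, map_pow, map_one, AdjoinRoot.mk_X] at h
  change ρ ^ 2 + ρ + 1 = 0 at h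
  linear_combination h

lemma exists_coords (z : Eisenstein) : ∃ a b : ℤ, z = (a : Eisenstein) + b * ρ := by
  induction z using AdjoinRoot.induction_on with
  | ih f =>
    induction f using Polynomial.induction_on with
    | C a => exact ⟨a, 0, by simp⟩
    | add f g hf hg =>
      obtain ⟨a, b, hf⟩ := hf
      obtain ⟨c, d, hg⟩ := hg
      refine ⟨a + c, b + d, ?_⟩
      rw [map_add, hf, hg]
      push_cast
      ring
    | monomial n a h =>
      obtain ⟨c, d, h⟩ := h
      refine ⟨-d, c - d, ?_⟩
      rw [pow_succ X n, ← mul_assoc, map_mul, h, AdjoinRoot.mk_X]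
      change _ * ρ = _
      push_cast
      linear_combination (d : Eisenstein) * rho_sq

lemma coords_eq_zero {a b : ℤ} (h : (a : Eisenstein) + b * ρ = 0) : a = 0 ∧ b = 0 := by
  have hd : (X ^ 2 + X + 1 : ℤ[X]).degree = 2 := by compute_degree!
  have hz : AdjoinRoot.mk (X ^ 2 + X + 1 : ℤ[X]) (C b * X + C a) = 0 := by
    rw [← h, map_add, map_mul, AdjoinRoot.mk_X, add_comm (a : Eisenstein)]
    simp [ρ]
  have h0 : C b * X + C a = 0 := by
    refine Polynomial.eq_zero_of_dvd_of_degree_lt (AdjoinRoot.mk_eq_zero.1 hz) ?_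
    rw [hd]
    exact degree_linear_lt_degree_C_mul_X_sq (a := 1) one_ne_zero |>.trans_eq (by simp)
  exact ⟨by simpa using congrArg (coeff · 0) h0,
    by simpa [coeff_C, -eq_intCast] using congrArg (coeff · 1) h0⟩

lemma coords_inj {a b c d : ℤ}
    (h : (a : Eisenstein) + b * ρ = (c : Eisenstein) + d * ρ) : a = c ∧ b = d := by
  have := coords_eq_zero (a := a - c) (b := b - d) (by push_cast; linear_combination h)
  omega

lemma coords_mul (a b c d : ℤ) :
    ((a : Eisenstein) + b * ρ) * ((c : Eisenstein) + d * ρ) =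
      ((a * c - b * d : ℤ) : Eisenstein) + ((a * d + b * c - b * d : ℤ) : Eisenstein) * ρ := by
  push_cast
  linear_combination (b * d : Eisenstein) * rho_sq

lemma mul_conj (a b : ℤ) :
    ((a : Eisenstein) + b * ρ) * (((a - b : ℤ) : Eisenstein) - b * ρ) =
      ((a ^ 2 - a * b + b ^ 2 : ℤ) : Eisenstein) := by
  push_cast
  linear_combination (-b ^ 2 : Eisenstein) * rho_sq

/-- Multiplicativity of the norm form. -/
lemma norm_eq_mul {a b c d e f : ℤ}
    (h : ((a : Eisenstein) + b * ρ) * ((c : Eisenstein) + d * ρ) = (e : Eisenstein) + f * ρ) :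
    (a ^ 2 - a * b + b ^ 2) * (c ^ 2 - c * d + d ^ 2) = e ^ 2 - e * f + f ^ 2 := by
  obtain ⟨rfl, rfl⟩ := coords_inj ((coords_mul a b c d).symm.trans h)
  ring

lemma norm_nonneg (a b : ℤ) : 0 ≤ a ^ 2 - a * b + b ^ 2 := by
  nlinarith [sq_nonneg (a - b), sq_nonneg a, sq_nonneg b]

lemma isUnit_of_norm_eq_one {a b : ℤ} (h : a ^ 2 - a * b + b ^ 2 = 1) :
    IsUnit ((a : Eisenstein) + b * ρ) := by
  refine IsUnit.of_mul_eq_one (((a - b : ℤ) : Eisenstein) - b * ρ) ?_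
  rw [mul_conj, h, Int.cast_one]

lemma norm_eq_one_of_isUnit {a b : ℤ} (h : IsUnit ((a : Eisenstein) + b * ρ)) :
    a ^ 2 - a * b + b ^ 2 = 1 := by
  obtain ⟨z, hz⟩ := h.exists_right_inv
  obtain ⟨c, d, rfl⟩ := exists_coords z
  have := norm_eq_mul (e := 1) (f := 0) (by rw [hz]; simp)
  exact Int.eq_one_of_mul_eq_one_right (norm_nonneg a b) (by simpa using this)

lemma norm_eq_of_associated {a b c d : ℤ}
    (h : Associated ((a : Eisenstein) + b * ρ) ((c : Eisenstein) + d * ρ)) :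
    a ^ 2 - a * b + b ^ 2 = c ^ 2 - c * d + d ^ 2 := by
  obtain ⟨u, hu⟩ := h
  obtain ⟨x, y, hxy⟩ := exists_coords (u : Eisenstein)
  have h1 := norm_eq_one_of_isUnit (hxy ▸ u.isUnit)
  rw [hxy] at hu
  rw [← norm_eq_mul hu, h1, mul_one]

lemma intCast_dvd_coords {n a b : ℤ} (h : (n : Eisenstein) ∣ (a : Eisenstein) + b * ρ) :
    n ∣ a ∧ n ∣ b := by
  obtain ⟨z, hz⟩ := h
  obtain ⟨c, d, rfl⟩ := exists_coords z
  obtain ⟨rfl, rfl⟩ := coords_inj (c := n * c) (d := n * d) (by rw [hz]; push_cast; ring)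
  exact ⟨dvd_mul_right _ _, dvd_mul_right _ _⟩

/-- Complex conjugation on `ℤ[ρ]`. -/
noncomputable def conj : Eisenstein →+* Eisenstein :=
  AdjoinRoot.lift (Int.castRingHom Eisenstein) (-1 - ρ) (by
    simp only [eval₂_add, eval₂_pow, eval₂_X, eval₂_one]
    linear_combination rho_sq)

lemma conj_rho : conj ρ = -1 - ρ := AdjoinRoot.lift_root _

lemma conj_coords (a b : ℤ) :
    conj ((a : Eisenstein) + b * ρ) = ((a - b : ℤ) : Eisenstein) - b * ρ := by
  rw [map_add, map_mul, map_intCast, map_intCast, conj_rho]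
  push_cast
  ring

lemma conj_conj (z : Eisenstein) : conj (conj z) = z := by
  obtain ⟨a, b, rfl⟩ := exists_coords z
  simp only [map_add, map_mul, map_sub, map_neg, map_one, map_intCast, conj_rho]
  ring

lemma prime_conj {z : Eisenstein} (hz : Prime z) : Prime (conj z) :=
  (MulEquiv.prime_iff (RingEquiv.ofRingHom conj conj
    (RingHom.ext conj_conj) (RingHom.ext conj_conj))).2 hz

lemma exists_dvd_sq_add_self_add_one {p : ℕ} (hp : p.Prime) (h : p % 3 ≠ 2) :
    ∃ x : ℤ, (p : ℤ) ∣ x ^ 2 + x + 1 := by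
  have := Fact.mk hp
  by_cases h0 : p % 3 = 0
  · obtain rfl := (Nat.prime_dvd_prime_iff_eq Nat.prime_three hp).1 (Nat.dvd_of_mod_eq_zero h0)
    exact ⟨1, by norm_num⟩
  have h3 : 3 ∣ Fintype.card (ZMod p)ˣ := by
    rw [ZMod.card_units]
    omega
  have : Fact (Nat.Prime 3) := ⟨Nat.prime_three⟩
  obtain ⟨u, hu⟩ := exists_prime_orderOf_dvd_card 3 h3
  obtain ⟨x, hx⟩ := ZMod.intCast_surjective (u : ZMod p)
  refine ⟨x, (ZMod.intCast_zmod_eq_zero_iff_dvd _ p).1 ?_⟩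
  have hu3 : (u : ZMod p) ^ 3 = 1 := by
    rw [← Units.val_pow_eq_pow_val, ← hu, pow_orderOf_eq_one, Units.val_one]
  have hu1 : (u : ZMod p) - 1 ≠ 0 := by
    intro h1
    have : u = 1 := Units.ext (sub_eq_zero.1 h1)
    simp [this] at hu
  push_cast
  rw [hx]
  exact (mul_eq_zero.1 (show ((u : ZMod p) - 1) * ((u : ZMod p) ^ 2 + u + 1) = 0 by
    linear_combination hu3)).resolve_left hu1

/-- A rational prime that stays prime in `ℤ[ρ]` is congruent to `2` modulo `3`. -/
lemma mod_three_eq_two_of_prime {p : ℕ} (hp : p.Prime) (h : Prime ((p : ℤ) : Eisenstein)) :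
    p % 3 = 2 := by
  by_contra h2
  obtain ⟨x, k, hk⟩ := exists_dvd_sq_add_self_add_one hp h2
  have hdvd : ((p : ℤ) : Eisenstein) ∣
      ((x : Eisenstein) + (-1 : ℤ) * ρ) * (((x + 1 : ℤ) : Eisenstein) + (1 : ℤ) * ρ) := by
    refine ⟨(k : Eisenstein), ?_⟩
    rw [← Int.cast_mul, ← hk]
    push_cast
    linear_combination -rho_sq
  have hp2 := hp.two_le
  rcases h.dvd_or_dvd hdvd with h | h
  · have := Int.le_of_dvd one_pos (Int.dvd_neg.1 (intCast_dvd_coords h).2)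
    omega
  · have := Int.le_of_dvd one_pos (intCast_dvd_coords h).2
    omega

lemma exists_prime_dvd {γ : Eisenstein} (hγ : Prime γ) :
    ∃ p : ℕ, p.Prime ∧ γ ∣ ((p : ℤ) : Eisenstein) := by
  have key : ∀ n : ℕ, n ≠ 0 → γ ∣ ((n : ℤ) : Eisenstein) →
      ∃ p : ℕ, p.Prime ∧ γ ∣ ((p : ℤ) : Eisenstein) := by
    intro n
    induction n using induction_on_primes with
    | zero => exact fun h => absurd rfl h
    | one => exact fun _ h => absurd (isUnit_of_dvd_one (by simpa using h)) hγ.not_isUnit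
    | prime_mul p n hp ih =>
      intro h0 h
      rw [Nat.cast_mul, Int.cast_mul] at h
      exact (hγ.dvd_or_dvd h).elim (fun h => ⟨p, hp, h⟩) (ih (right_ne_zero_of_mul h0))
  obtain ⟨a, b, rfl⟩ := exists_coords γ
  have hn := norm_nonneg a b
  refine key (a ^ 2 - a * b + b ^ 2).natAbs ?_ ?_
  · intro h
    rw [Int.natAbs_eq_zero] at h
    have hb : b = 0 := by nlinarith [sq_nonneg (2 * a - b), sq_nonneg b]
    have ha : a = 0 := by simpa [hb] using h
    exact hγ.ne_zero (by simp [ha, hb])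
  · rw [Int.natAbs_of_nonneg hn, ← mul_conj]
    exact dvd_mul_right _ _

lemma associated_beta_of_norm_eq_three {a b : ℤ} (h : a ^ 2 - a * b + b ^ 2 = 3) :
    Associated ((a : Eisenstein) + b * ρ) β := by
  have h3 : (3 : ℤ) ∣ a + b := by
    refine Int.prime_three.dvd_of_dvd_pow (n := 2) ⟨1 + a * b, ?_⟩
    linear_combination h
  obtain ⟨d, hd⟩ := h3
  obtain rfl : b = 3 * d - a := by omega
  have hu := isUnit_of_norm_eq_one (a := a - d) (b := d) (by nlinarith)
  refine Associated.symm ⟨hu.unit, ?_⟩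
  rw [IsUnit.unit_spec, β]
  push_cast
  linear_combination (-d : Eisenstein) * rho_sq

lemma not_associated_conj {a b : ℤ} {p : ℕ} (hp : p.Prime) (hp3 : p % 3 = 1)
    (h : a ^ 2 - a * b + b ^ 2 = p) :
    ¬ Associated ((a : Eisenstein) + b * ρ) (((a - b : ℤ) : Eisenstein) - b * ρ) := by
  intro hass
  have hpZ : Prime (p : ℤ) := Nat.prime_iff_prime_int.1 hp
  have hsq : ((p : ℤ) : Eisenstein) ∣ ((a * (a - 2 * b) : ℤ) : Eisenstein) +
      ((-(b * (2 * a - b)) : ℤ) : Eisenstein) * ρ := by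
    obtain ⟨z, hz⟩ := hass.dvd
    refine ⟨z, ?_⟩
    rw [← h, ← mul_conj, mul_right_comm, ← hz]
    push_cast
    linear_combination (-b ^ 2 : Eisenstein) * rho_sq
  obtain ⟨h1, h2⟩ := intCast_dvd_coords hsq
  have h_not_both : ¬ ((p : ℤ) ∣ a ∧ (p : ℤ) ∣ b) := by
    rintro ⟨⟨x, rfl⟩, ⟨y, rfl⟩⟩
    have hone : (p : ℤ) * (x ^ 2 - x * y + y ^ 2) = 1 :=
      mul_left_cancel₀ hpZ.ne_zero (by linear_combination h)
    exact hpZ.not_isUnit (IsUnit.of_mul_eq_one _ hone)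
  have hiff : (p : ℤ) ∣ a ↔ (p : ℤ) ∣ b := by
    constructor <;> rintro ⟨x, rfl⟩ <;> refine hpZ.dvd_of_dvd_pow (n := 2) ?_
    · exact ⟨1 - p * x ^ 2 + x * b, by linear_combination h⟩
    · exact ⟨1 - p * x ^ 2 + x * a, by linear_combination h⟩
  have ha : ¬ (p : ℤ) ∣ a := fun ha => h_not_both ⟨ha, hiff.1 ha⟩
  have hb : ¬ (p : ℤ) ∣ b := fun hb => ha (hiff.2 hb)
  have h1' := (hpZ.dvd_or_dvd h1).resolve_left ha
  have h2' := (hpZ.dvd_or_dvd (Int.dvd_neg.1 h2)).resolve_left hb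
  have h3 : (p : ℤ) ∣ 3 * b := by
    have := dvd_sub h2' (h1'.mul_left 2)
    ring_nf at this ⊢
    exact this
  have h4 := (hpZ.dvd_or_dvd h3).resolve_right hb
  have h5 : p ∣ 3 := by exact_mod_cast h4
  rw [Nat.prime_dvd_prime_iff_eq hp Nat.prime_three] at h5
  omega

lemma exists_cat {γ : Eisenstein} (hγ : Prime γ) : IsCat1 γ ∨ IsCat2 γ ∨ IsCat3 γ := by
  obtain ⟨p, hp, δ, hδ⟩ := exists_prime_dvd hγ
  have hpZ : Prime (p : ℤ) := Nat.prime_iff_prime_int.1 hp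
  obtain ⟨a, b, rfl⟩ := exists_coords γ
  obtain ⟨c, d, rfl⟩ := exists_coords δ
  have hN : (a ^ 2 - a * b + b ^ 2) * (c ^ 2 - c * d + d ^ 2) = (p : ℤ) ^ 2 := by
    have := norm_eq_mul (e := p) (f := 0) (by rw [← hδ]; simp)
    simpa using this
  obtain ⟨i, hi, hassoc⟩ := (dvd_prime_pow hpZ 2).1 (Dvd.intro _ hN)
  have hNi : a ^ 2 - a * b + b ^ 2 = (p : ℤ) ^ i :=
    Int.eq_of_associated_of_nonneg hassoc (norm_nonneg a b) (by positivity)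
  interval_cases i
  · exact absurd (isUnit_of_norm_eq_one (by simpa using hNi)) hγ.not_isUnit
  · rw [pow_one] at hNi
    by_cases h0 : p % 3 = 0
    · obtain rfl := (Nat.prime_dvd_prime_iff_eq Nat.prime_three hp).1 (Nat.dvd_of_mod_eq_zero h0)
      exact Or.inl (associated_beta_of_norm_eq_three hNi)
    have hsq : (a + b) ^ 2 % 3 = (p : ℤ) % 3 := by
      rw [← hNi, show (a + b) ^ 2 = a ^ 2 - a * b + b ^ 2 + 3 * (a * b) by ring]
      simp
    have h1 : p % 3 = 1 := by
      have : (a + b) % 3 = 0 ∨ (a + b) % 3 = 1 ∨ (a + b) % 3 = 2 := by omega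
      rcases this with h | h | h <;> simp [pow_two, Int.mul_emod, h] at hsq <;> omega
    refine Or.inr (Or.inr ⟨a, b, p, hpZ, ?_, hNi, Associated.refl _, hγ, ?_,
      not_associated_conj hp h1 hNi, ?_⟩)
    · change (p : ℤ) % 3 = 1 % 3
      omega
    · rw [← conj_coords]
      exact prime_conj hγ
    · rw [mul_conj, hNi]
  · have hδ1 : c ^ 2 - c * d + d ^ 2 = 1 := by
      rw [hNi] at hN
      exact mul_left_cancel₀ (pow_ne_zero 2 hpZ.ne_zero) (hN.trans (mul_one _).symm)
    have hu := isUnit_of_norm_eq_one hδ1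
    have hass : Associated ((a : Eisenstein) + b * ρ) ((p : ℤ) : Eisenstein) :=
      ⟨hu.unit, by rw [IsUnit.unit_spec, hδ]⟩
    have h2 := mod_three_eq_two_of_prime hp (hass.prime hγ)
    refine Or.inr (Or.inl ⟨p, hpZ, ?_, hass⟩)
    change (p : ℤ) % 3 = 2 % 3
    omega

lemma norm_of_isCat1 {a b : ℤ} (h : IsCat1 ((a : Eisenstein) + b * ρ)) :
    a ^ 2 - a * b + b ^ 2 = 3 := by
  have hβ : β = ((1 : ℤ) : Eisenstein) + ((-1 : ℤ) : Eisenstein) * ρ := by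
    rw [β]
    push_cast
    ring
  rw [IsCat1, hβ] at h
  simpa using norm_eq_of_associated h

lemma norm_of_isCat2 {a b : ℤ} (h : IsCat2 ((a : Eisenstein) + b * ρ)) :
    ∃ p : ℤ, a ^ 2 - a * b + b ^ 2 = p ^ 2 := by
  obtain ⟨p, -, -, h⟩ := h
  refine ⟨p, ?_⟩
  have := norm_eq_of_associated (c := p) (d := 0) (by simpa using h)
  simpa using this

lemma norm_of_isCat3 {a b : ℤ} (h : IsCat3 ((a : Eisenstein) + b * ρ)) :
    Prime (a ^ 2 - a * b + b ^ 2) ∧ a ^ 2 - a * b + b ^ 2 ≡ 1 [ZMOD 3] := by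
  obtain ⟨c, d, q, hq, hq1, hcd, h, -⟩ := h
  rw [norm_eq_of_associated h, hcd]
  exact ⟨hq, hq1⟩

end Eisenstein

theorem stmt3 (γ : Eisenstein) (hγ : Prime γ) :
    (IsCat1 γ ∨ IsCat2 γ ∨ IsCat3 γ) ∧
    ¬ (IsCat1 γ ∧ IsCat2 γ) ∧ ¬ (IsCat1 γ ∧ IsCat3 γ) ∧ ¬ (IsCat2 γ ∧ IsCat3 γ) := by
  refine ⟨Eisenstein.exists_cat hγ, ?_⟩
  obtain ⟨a, b, rfl⟩ := Eisenstein.exists_coords γ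
  refine ⟨fun ⟨h1, h2⟩ => ?_, fun ⟨h1, h3⟩ => ?_, fun ⟨h2, h3⟩ => ?_⟩
  · obtain ⟨p, hp⟩ := Eisenstein.norm_of_isCat2 h2
    rw [Eisenstein.norm_of_isCat1 h1] at hp
    exact Int.prime_three.not_isSquare ⟨p, hp.trans (pow_two p)⟩
  · have h := (Eisenstein.norm_of_isCat3 h3).2
    rw [Eisenstein.norm_of_isCat1 h1] at h
    exact absurd h (by decide)
  · obtain ⟨p, hp⟩ := Eisenstein.norm_of_isCat2 h2
    exact (Eisenstein.norm_of_isCat3 h3).1.not_isSquare ⟨p, hp.trans (pow_two p)⟩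
end

section
/- For every natural number m, the 3^{2m+1} Eisenstein integers a + bρ with 0 ≤ a ≤ 3^{m+1} − 1 and 0 ≤ b ≤ 3^m − 1 form a complete set of residues modulo β^{2m+1}, where β = 1 − ρ: every element of ℤ[ρ] is congruent modulo β^{2m+1} to exactly one element of this set. In particular, the quotient ring ℤ[ρ]/(β^{2m+1}) has cardinality 3^{2m+1}. -/
open Polynomial

theorem rho_sq : ρ ^ 2 = -1 - ρ := by
  have h : AdjoinRoot.mk (X ^ 2 + X + 1 : ℤ[X]) (X ^ 2 + X + 1) = 0 := AdjoinRoot.mk_self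
  simp only [map_add, map_pow, map_one, AdjoinRoot.mk_X] at h
  change ρ ^ 2 + ρ + 1 = 0 at h
  linear_combination h

theorem exists_eq_add_mul_rho (θ : Eisenstein) : ∃ a b : ℤ, θ = a + b * ρ := by
  induction θ using AdjoinRoot.induction_on with
  | ih p =>
    induction p using Polynomial.induction_on' with
    | add p q hp hq =>
      obtain ⟨a, b, h⟩ := hp
      obtain ⟨c, d, h'⟩ := hq
      exact ⟨a + c, b + d, by rw [map_add, h, h']; push_cast; ring⟩
    | monomial n r =>
      rw [← C_mul_X_pow_eq_monomial]
      induction n with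
      | zero => exact ⟨r, 0, by simp⟩
      | succ n ih =>
        obtain ⟨a, b, h⟩ := ih
        refine ⟨-b, a - b, ?_⟩
        rw [pow_succ X n, ← mul_assoc, map_mul, h, AdjoinRoot.mk_X]
        change (a + b * ρ) * ρ = _
        push_cast
        linear_combination (b : Eisenstein) * rho_sq

theorem eq_zero_of_add_mul_rho_eq_zero {a b : ℤ} (h : (a : Eisenstein) + b * ρ = 0) :
    a = 0 ∧ b = 0 := by
  have hmonic : (X ^ 2 + X + 1 : ℤ[X]).Monic := by monicity!
  have hdeg : (X ^ 2 + X + 1 : ℤ[X]).degree = 2 := by compute_degree!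
  have hmk : AdjoinRoot.mk (X ^ 2 + X + 1 : ℤ[X]) (C b * X + C a) = 0 := by
    rw [← h, ρ]
    simp [add_comm]
  have hzero : (C b * X + C a : ℤ[X]) = 0 := by
    by_contra hne
    refine hmonic.not_dvd_of_degree_lt hne ?_ (AdjoinRoot.mk_eq_zero.mp hmk)
    rw [hdeg]
    exact degree_linear_lt
  exact ⟨by simpa using congrArg (coeff · 0) hzero,
    by simpa [-eq_intCast, coeff_C] using congrArg (coeff · 1) hzero⟩

theorem beta_sq : β ^ 2 = -3 * ρ := by
  rw [β]
  linear_combination rho_sq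

theorem isUnit_neg_rho : IsUnit (-ρ) :=
  IsUnit.of_mul_eq_one (1 + ρ) (by linear_combination -rho_sq)

/-- `β ^ (2 * m + 1)` is associated to `3 ^ m * β`. -/
theorem beta_pow_dvd_iff (m : ℕ) (θ : Eisenstein) :
    β ^ (2 * m + 1) ∣ θ ↔ 3 ^ m * β ∣ θ := by
  have h : β ^ (2 * m + 1) = 3 ^ m * β * (-ρ) ^ m := by
    rw [pow_succ, pow_mul, beta_sq, show (-3 * ρ : Eisenstein) = 3 * -ρ by ring, mul_pow]
    ring
  rw [h, (isUnit_neg_rho.pow m).mul_right_dvd]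

theorem beta_pow_dvd_add_mul_rho_iff (m : ℕ) (a b : ℤ) :
    β ^ (2 * m + 1) ∣ (a : Eisenstein) + b * ρ ↔ 3 ^ m ∣ b ∧ 3 ^ (m + 1) ∣ a + b := by
  rw [beta_pow_dvd_iff]
  constructor
  · rintro ⟨γ, h⟩
    obtain ⟨c, d, rfl⟩ := exists_eq_add_mul_rho γ
    obtain ⟨ha, hb⟩ := eq_zero_of_add_mul_rho_eq_zero
      (a := a - 3 ^ m * (c + d)) (b := b - 3 ^ m * (2 * d - c)) (by
        push_cast
        rw [β] at h
        linear_combination h - (3 : Eisenstein) ^ m * d * rho_sq)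
    exact ⟨⟨2 * d - c, by linarith⟩, ⟨d, by rw [pow_succ]; linarith⟩⟩
  · rintro ⟨⟨k, hk⟩, ⟨d, hd⟩⟩
    obtain rfl : a = 3 ^ m * (3 * d - k) := by
      rw [pow_succ] at hd
      linarith
    subst hk
    refine ⟨((2 * d - k : ℤ) : Eisenstein) + d * ρ, ?_⟩
    rw [β]
    push_cast
    linear_combination (3 : Eisenstein) ^ m * d * rho_sq

theorem existsUnique_residue (m : ℕ) (θ : Eisenstein) : ∃! x : ℤ × ℤ,
    0 ≤ x.1 ∧ x.1 ≤ 3 ^ (m + 1) - 1 ∧ 0 ≤ x.2 ∧ x.2 ≤ 3 ^ m - 1 ∧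
      β ^ (2 * m + 1) ∣ θ - ((x.1 : Eisenstein) + x.2 * ρ) := by
  obtain ⟨p, q, rfl⟩ := exists_eq_add_mul_rho θ
  have hdvd (x y : ℤ) : β ^ (2 * m + 1) ∣ (p : Eisenstein) + q * ρ - (x + y * ρ) ↔
      3 ^ m ∣ q - y ∧ 3 ^ (m + 1) ∣ p + q - y - x := by
    rw [show p + q - y - x = p - x + (q - y) by ring, ← beta_pow_dvd_add_mul_rho_iff]
    push_cast
    ring_nf
  simp only [hdvd]
  have hM : (0 : ℤ) < 3 ^ m := by positivity
  have hN : (0 : ℤ) < 3 ^ (m + 1) := by positivity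
  refine ⟨((p + q - q % 3 ^ m) % 3 ^ (m + 1), q % 3 ^ m),
    ⟨Int.emod_nonneg _ hN.ne', Int.le_sub_one_of_lt (Int.emod_lt_of_pos _ hN),
      Int.emod_nonneg _ hM.ne', Int.le_sub_one_of_lt (Int.emod_lt_of_pos _ hM),
      Int.dvd_self_sub_emod, Int.dvd_self_sub_emod⟩, ?_⟩
  rintro ⟨x, y⟩ ⟨hx, hx', hy, hy', hqy, hpx⟩
  dsimp only at hx hx' hy hy' hqy hpx
  have hyq : y = q % 3 ^ m := by
    rw [← Int.emod_eq_of_lt hy (Int.lt_of_le_sub_one hy')]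
    exact Int.emod_eq_emod_iff_emod_sub_eq_zero.mpr
      (Int.emod_eq_zero_of_dvd (dvd_sub_comm.mp hqy))
  have hxp : x = (p + q - y) % 3 ^ (m + 1) := by
    rw [← Int.emod_eq_of_lt hx (Int.lt_of_le_sub_one hx')]
    exact Int.emod_eq_emod_iff_emod_sub_eq_zero.mpr
      (Int.emod_eq_zero_of_dvd (dvd_sub_comm.mp hpx))
  rw [hxp, hyq]

theorem card_quotient_beta_pow (m : ℕ) :
    Nat.card (Eisenstein ⧸ Ideal.span {β ^ (2 * m + 1)}) = 3 ^ (2 * m + 1) := by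
  let S : Finset (ℤ × ℤ) := Finset.Icc 0 (3 ^ (m + 1) - 1) ×ˢ Finset.Icc 0 (3 ^ m - 1)
  let f : S → Eisenstein ⧸ Ideal.span {β ^ (2 * m + 1)} := fun x =>
    Ideal.Quotient.mk _ ((x.1.1 : Eisenstein) + x.1.2 * ρ)
  have hf : Function.Bijective f := by
    refine (Function.bijective_iff_existsUnique f).mpr fun z => ?_
    obtain ⟨θ, rfl⟩ := Ideal.Quotient.mk_surjective z
    obtain ⟨x, ⟨h₁, h₂, h₃, h₄, hx⟩, hunique⟩ := existsUnique_residue m θ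
    refine ⟨⟨x, by simp [S, *]⟩, ?_, ?_⟩
    · exact (Ideal.Quotient.mk_eq_mk_iff_sub_mem _ _).mpr
        (Ideal.mem_span_singleton.mpr (dvd_sub_comm.mp hx))
    · rintro ⟨y, hy⟩ hfy
      have hdvd := Ideal.mem_span_singleton.mp
        ((Ideal.Quotient.mk_eq_mk_iff_sub_mem _ _).mp hfy)
      simp only [S, Finset.mem_product, Finset.mem_Icc] at hy
      exact Subtype.ext (hunique y ⟨hy.1.1, hy.1.2, hy.2.1, hy.2.2, dvd_sub_comm.mp hdvd⟩)
  rw [← Nat.card_eq_of_bijective f hf, Nat.card_eq_fintype_card, Fintype.card_coe,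
    Finset.card_product, Int.card_Icc, Int.card_Icc]
  have hpow (n : ℕ) : ((3 : ℤ) ^ n - 1 + 1 - 0).toNat = 3 ^ n := by
    rw [sub_add_cancel, sub_zero]
    exact_mod_cast Int.toNat_natCast (3 ^ n)
  rw [hpow, hpow, ← pow_add]
  congr 1
  ring

theorem stmt8 (m : ℕ) :
    (∀ θ : Eisenstein, ∃! x : ℤ × ℤ,
      0 ≤ x.1 ∧ x.1 ≤ 3 ^ (m + 1) - 1 ∧ 0 ≤ x.2 ∧ x.2 ≤ 3 ^ m - 1 ∧
        β ^ (2 * m + 1) ∣ θ - ((x.1 : Eisenstein) + x.2 * ρ)) ∧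
    Nat.card (Eisenstein ⧸ Ideal.span {β ^ (2 * m + 1)}) = 3 ^ (2 * m + 1) :=
  ⟨existsUnique_residue m, card_quotient_beta_pow m⟩
end

section
/- (Euler–Fermat theorem for the Eisenstein integers.) Let θ, η ∈ ℤ[ρ] be nonzero with θ and η coprime (1 is a greatest common divisor of θ and η in ℤ[ρ]). Then θ^{φ_ρ(η)} ≡ 1 (mod η), i.e., η divides θ^{φ_ρ(η)} − 1 in ℤ[ρ]. -/
open Polynomial

/-- The minimal polynomial over `ℤ` of a primitive cube root of unity is `X² + X + 1`. -/
theorem IsPrimitiveRoot.minpoly_int_of_three {K : Type*} [Field K] [CharZero K] {ζ : K}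
    (hζ : IsPrimitiveRoot ζ 3) : minpoly ℤ ζ = X ^ 2 + X + 1 := by
  rw [← cyclotomic_eq_minpoly hζ (by norm_num), cyclotomic_three]

/-- `ℤ[ρ]` is isomorphic to the ring of integers of the third cyclotomic field, hence a principal
ideal ring. -/
theorem Eisenstein.isPrincipalIdealRing_of_isCyclotomicExtension (K : Type*) [Field K]
    [NumberField K] [IsCyclotomicExtension {3} ℚ K] : IsPrincipalIdealRing Eisenstein := by
  have : IsPrincipalIdealRing (NumberField.RingOfIntegers K) :=
    IsCyclotomicExtension.Rat.three_pid K
  have hζ := IsCyclotomicExtension.zeta_spec 3 ℚ K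
  have hmin : minpoly ℤ hζ.integralPowerBasis.gen = X ^ 2 + X + 1 := by
    rw [hζ.integralPowerBasis_gen, ← hζ.minpoly_int_of_three]
    exact (minpoly.algebraMap_eq NumberField.RingOfIntegers.coe_injective hζ.toInteger).symm
  let e := AdjoinRoot.equiv' (X ^ 2 + X + 1 : ℤ[X]) hζ.integralPowerBasis
    (by rw [hmin, AdjoinRoot.aeval_eq, AdjoinRoot.mk_self])
    (by rw [← hmin, minpoly.aeval])
  exact IsPrincipalIdealRing.of_surjective e.symm e.symm.surjective

instance Eisenstein.isPrincipalIdealRing : IsPrincipalIdealRing Eisenstein := by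
  -- The `ℚ`-algebra structure has to be the one coming from characteristic zero.
  have : @IsCyclotomicExtension {3} ℚ (CyclotomicField 3 ℚ) _ _ DivisionRing.toRatAlgebra :=
    CyclotomicField.isCyclotomicExtension 3 ℚ
  exact isPrincipalIdealRing_of_isCyclotomicExtension (CyclotomicField 3 ℚ)

/-- The Euler–Fermat theorem modulo a principal ideal of a commutative ring. -/
theorem IsCoprime.dvd_pow_card_units_sub_one {R : Type*} [CommRing R] {a b : R}
    (h : IsCoprime a b) : b ∣ a ^ Nat.card (R ⧸ Ideal.span {b})ˣ - 1 := by
  have hu : IsUnit (Ideal.Quotient.mk (Ideal.span {b}) a) := by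
    obtain ⟨u, v, huv⟩ := h
    refine IsUnit.of_mul_eq_one (Ideal.Quotient.mk _ u) ?_
    rw [← map_mul, ← map_one (Ideal.Quotient.mk _), Ideal.Quotient.mk_eq_mk_iff_sub_mem,
      Ideal.mem_span_singleton]
    exact ⟨-v, by linear_combination huv⟩
  obtain ⟨w, hw⟩ := hu
  rw [← Ideal.mem_span_singleton, ← Ideal.Quotient.mk_eq_mk_iff_sub_mem, map_pow, map_one, ← hw,
    ← Units.val_pow_eq_pow_val, pow_card_eq_one', Units.val_one]

theorem stmt17 (θ η : Eisenstein) (hθ : θ ≠ 0) (hη : η ≠ 0) (h : IsRelPrime θ η) :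
    η ∣ θ ^ Nat.card (Eisenstein ⧸ Ideal.span {η})ˣ - 1 := by
  exact h.isCoprime.dvd_pow_card_units_sub_one
end

section
/- Let η ∈ ℤ[ρ] be nonzero. If η is not a unit of ℤ[ρ] and η is not an associate of 2 (i.e., η is not a unit of ℤ[ρ] times 2), then φ_ρ(η) is an even integer. (In the excluded cases, φ_ρ(η) = 1 when η is a unit and φ_ρ(η) = 3 when η is an associate of 2.) -/
open Polynomial

theorem Ideal.natCard_units_quotient_span_singleton_of_associated {R : Type*} [CommRing R]
    {a b : R} (h : Associated a b) :
    Nat.card (R ⧸ Ideal.span {a})ˣ = Nat.card (R ⧸ Ideal.span {b})ˣ := by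
  obtain ⟨u, rfl⟩ := h
  rw [Ideal.span_singleton_mul_right_unit u.isUnit]

theorem Ideal.even_natCard_units_quotient {R : Type*} [CommRing R] {I : Ideal R}
    (h : (2 : R) ∉ I) : Even (Nat.card (R ⧸ I)ˣ) := by
  have hne : (-1 : (R ⧸ I)ˣ) ≠ 1 := by
    intro h1
    have h2 : (-1 : R ⧸ I) = 1 := by simpa using congrArg Units.val h1
    refine h (Ideal.Quotient.eq_zero_iff_mem.mp ?_)
    rw [map_ofNat]
    linear_combination -h2
  have horder : orderOf (-1 : (R ⧸ I)ˣ) = 2 := orderOf_eq_prime (by simp) hne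
  exact even_iff_two_dvd.mpr (horder ▸ orderOf_dvd_natCard _)

namespace Eisenstein

instance : IsDomain Eisenstein := by
  refine AdjoinRoot.isDomain_of_prime (Irreducible.prime ?_)
  rw [← cyclotomic_three]
  exact cyclotomic.irreducible (by norm_num)

/-- The residue field of `ℤ` at `2`. -/
local notation "𝔽₂" => ℤ ⧸ Ideal.span {(2 : ℤ)}

instance : (Ideal.span {(2 : ℤ)}).IsMaximal :=
  PrincipalIdealRing.isMaximal_of_irreducible Int.prime_two.irreducible

noncomputable local instance : Field 𝔽₂ := Ideal.Quotient.field _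

theorem monic_X_sq_add_X_add_one : (X ^ 2 + X + 1 : 𝔽₂[X]).Monic := by monicity!

theorem natDegree_X_sq_add_X_add_one : (X ^ 2 + X + 1 : 𝔽₂[X]).natDegree = 2 := by compute_degree!

theorem irreducible_X_sq_add_X_add_one : Irreducible (X ^ 2 + X + 1 : 𝔽₂[X]) := by
  rw [monic_X_sq_add_X_add_one.irreducible_iff_roots_eq_zero_of_degree_le_three
    natDegree_X_sq_add_X_add_one.ge
    (by rw [natDegree_X_sq_add_X_add_one]; norm_num), Multiset.eq_zero_iff_forall_notMem]
  intro x hx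
  obtain ⟨n, rfl⟩ := Ideal.Quotient.mk_surjective x
  have hroot := (mem_roots'.mp hx).2
  simp only [IsRoot.def, eval_add, eval_pow, eval_X, eval_one] at hroot
  rw [← map_pow, ← map_add, ← map_one (Ideal.Quotient.mk _), ← map_add,
    Ideal.Quotient.eq_zero_iff_mem, Ideal.mem_span_singleton] at hroot
  have heven := Int.even_mul_succ_self n
  rw [even_iff_two_dvd] at heven
  rw [show n ^ 2 + n + 1 = n * (n + 1) + 1 by ring, dvd_add_right heven] at hroot
  norm_num at hroot

/-- Reduction modulo `2` identifies `ℤ[ρ]/(2)` with `𝔽₂[X]/(X² + X + 1)`. -/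
noncomputable def quotientTwoEquiv :
    Eisenstein ⧸ Ideal.span {(2 : Eisenstein)} ≃+* 𝔽₂[X] ⧸ Ideal.span {(X ^ 2 + X + 1 : 𝔽₂[X])} :=
  (Ideal.quotEquivOfEq (by rw [Ideal.map_span, Set.image_singleton, map_ofNat])).trans <|
    (AdjoinRoot.quotAdjoinRootEquivQuotPolynomialQuot (Ideal.span {(2 : ℤ)})
      (X ^ 2 + X + 1 : ℤ[X])).trans <|
    Ideal.quotEquivOfEq (by simp)

instance : (Ideal.span {(X ^ 2 + X + 1 : 𝔽₂[X])}).IsMaximal :=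
  PrincipalIdealRing.isMaximal_of_irreducible irreducible_X_sq_add_X_add_one

theorem prime_two : Prime (2 : Eisenstein) := by
  have hfield : IsField (Eisenstein ⧸ Ideal.span {(2 : Eisenstein)}) :=
    quotientTwoEquiv.toMulEquiv.isField
      ((Ideal.Quotient.maximal_ideal_iff_isField_quotient _).mp inferInstance)
  have hprime := (Ideal.Quotient.maximal_of_isField _ hfield).isPrime
  refine (Ideal.span_singleton_prime ?_).mp hprime
  intro h
  have hinj := AdjoinRoot.of.injective_of_degree_ne_zero
    (f := (X ^ 2 + X + 1 : ℤ[X])) (by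
      rw [show (X ^ 2 + X + 1 : ℤ[X]).degree = 2 by compute_degree!]; norm_num)
  have := hinj (a₁ := 2) (a₂ := 0) (by simpa using h)
  norm_num at this

theorem natCard_units_quotient_two :
    Nat.card (Eisenstein ⧸ Ideal.span {(2 : Eisenstein)})ˣ = 3 := by
  rw [Nat.card_congr (Units.mapEquiv quotientTwoEquiv.toMulEquiv).toEquiv]
  have hcard : Nat.card 𝔽₂ = 2 := by
    rw [Nat.card_congr (Int.quotientSpanEquivZMod 2).toEquiv]
    simp
  let _ : Field (𝔽₂[X] ⧸ Ideal.span {(X ^ 2 + X + 1 : 𝔽₂[X])}) := Ideal.Quotient.field _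
  have : Module.Finite 𝔽₂ (𝔽₂[X] ⧸ Ideal.span {(X ^ 2 + X + 1 : 𝔽₂[X])}) :=
    monic_X_sq_add_X_add_one.finite_quotient
  rw [Nat.card_units, Module.natCard_eq_pow_finrank (K := 𝔽₂), hcard,
    finrank_quotient_span_eq_natDegree, natDegree_X_sq_add_X_add_one]
  norm_num

end Eisenstein

theorem stmt18 (η : Eisenstein) (hη : η ≠ 0) :
    (¬ IsUnit η → ¬ Associated η 2 → Even (Nat.card (Eisenstein ⧸ Ideal.span {η})ˣ)) ∧
    (IsUnit η → Nat.card (Eisenstein ⧸ Ideal.span {η})ˣ = 1) ∧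
    (Associated η 2 → Nat.card (Eisenstein ⧸ Ideal.span {η})ˣ = 3) := by
  refine ⟨fun hunit hassoc => Ideal.even_natCard_units_quotient ?_, fun hunit => ?_, fun h => ?_⟩
  · rw [Ideal.mem_span_singleton]
    intro hdvd
    exact (Eisenstein.prime_two.irreducible.dvd_iff.mp hdvd).elim hunit fun h => hassoc h.symm
  · have := Ideal.Quotient.subsingleton_iff.mpr (Ideal.span_singleton_eq_top.mpr hunit)
    exact Nat.card_unique
  · rw [Ideal.natCard_units_quotient_span_singleton_of_associated h,
      Eisenstein.natCard_units_quotient_two]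
end
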